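/- Characterization of idempotency of the NDMPI: with the Hartwig–Spindelböck decomposition data as in the context and Â^N := Û · fromBlocks(K*Σ₁⁻¹, 0, L*Σ₁⁻¹, 0) · Û* (the NDMPI of Â), the matrix Â^N is idempotent ((Â^N)² = Â^N) if and only if Σ₁ = K. -/

import Mathlib

open Matrix

/-- The dual complex numbers `𝔻ℂ := ℂ[ε]`, the trivial square-zero extension of `ℂ` by `ℂ`. -/
abbrev DC := TrivSqZeroExt ℂ ℂ

/-- Star on dual complex numbers: `(a + b·ε)* = conj a + conj b · ε`. -/
instance : Star DC :=
  ⟨fun x => ((starRingEnd ℂ) x.fst, (starRingEnd ℂ) x.snd)⟩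

/-- A positive appreciable real dual number: the standard part is a positive real and
the dual part is real. -/
def PosAppreciable (x : DC) : Prop :=
  (∃ a : ℝ, 0 < a ∧ x.fst = (a : ℂ)) ∧ (∃ b : ℝ, x.snd = (b : ℂ))

/-- A nonnegative infinitesimal real dual number: the standard part is `0` and
the dual part is a nonnegative real. -/
def NonnegInfinitesimal (x : DC) : Prop :=
  x.fst = 0 ∧ ∃ b : ℝ, 0 ≤ b ∧ x.snd = (b : ℂ)

/-- The standard part of a dual complex matrix. -/
def stdPart {m n : Type*} (X : Matrix m n DC) : Matrix m n ℂ :=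
  X.map TrivSqZeroExt.fst

/-- The dual part of a dual complex matrix. -/
def dualPart {m n : Type*} (X : Matrix m n DC) : Matrix m n ℂ :=
  X.map TrivSqZeroExt.snd

theorem star_star_dualComplex (x : DC) : star (star x) = x := by
  refine TrivSqZeroExt.ext ?_ ?_
  · exact Complex.conj_conj x.fst
  · exact Complex.conj_conj x.snd

theorem conjTranspose_conjTranspose_dualComplex {m n : Type*} (X : Matrix m n DC) :
    Xᴴᴴ = X := by
  ext1 i j
  exact star_star_dualComplex (X i j)

theorem PosAppreciable.star_eq {x : DC} (hx : PosAppreciable x) : star x = x := by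
  obtain ⟨⟨a, -, ha⟩, b, hb⟩ := hx
  refine TrivSqZeroExt.ext ?_ ?_
  · change (starRingEnd ℂ) x.fst = x.fst
    rw [ha, Complex.conj_ofReal]
  · change (starRingEnd ℂ) x.snd = x.snd
    rw [hb, Complex.conj_ofReal]

theorem PosAppreciable.isUnit {x : DC} (hx : PosAppreciable x) : IsUnit x := by
  obtain ⟨⟨a, ha₀, ha⟩, -⟩ := hx
  rw [TrivSqZeroExt.isUnit_iff_isUnit_fst, isUnit_iff_ne_zero, ha]
  exact_mod_cast ha₀.ne'

theorem conjTranspose_diagonal_of_posAppreciable {n : Type*} [DecidableEq n] {d : n → DC}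
    (hd : ∀ i, PosAppreciable (d i)) : (Matrix.diagonal d)ᴴ = Matrix.diagonal d := by
  ext1 i j
  rw [conjTranspose_apply]
  rcases eq_or_ne i j with rfl | hij
  · rw [diagonal_apply_eq, (hd i).star_eq]
  · rw [diagonal_apply_ne _ hij, diagonal_apply_ne _ hij.symm]
    refine TrivSqZeroExt.ext ?_ ?_
    · exact map_zero (starRingEnd ℂ)
    · exact map_zero (starRingEnd ℂ)

/-- Conjugation by an invertible element preserves and reflects idempotency. -/
theorem conj_mul_self_eq_iff {R : Type*} [Monoid R] {u v : R} (h : v * u = 1) (b : R) :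
    u * b * v * (u * b * v) = u * b * v ↔ b * b = b := by
  have hsq : u * b * v * (u * b * v) = u * (b * b) * v := by
    simp only [mul_assoc]
    rw [← mul_assoc v u, h, one_mul]
  have hcancel (c : R) : v * (u * c * v) * u = c := by
    rw [mul_assoc u, ← mul_assoc v, h, one_mul, mul_assoc, h, mul_one]
  rw [hsq]
  refine ⟨fun hb => ?_, fun hb => by rw [hb]⟩
  rw [← hcancel (b * b), hb, hcancel]

/-- Characterization of idempotency of the NDMPI. -/
theorem ndmpi_idempotent_iff
    {r s : ℕ}
    -- `Û`, a unitary matrix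
    (U : Matrix (Fin r ⊕ Fin s) (Fin r ⊕ Fin s) DC)
    (hU₁ : U * Uᴴ = 1) (hU₂ : Uᴴ * U = 1)
    -- the blocks `K, L, M, N` forming a unitary block matrix
    (K : Matrix (Fin r) (Fin r) DC) (L : Matrix (Fin r) (Fin s) DC)
    (M : Matrix (Fin s) (Fin r) DC) (N : Matrix (Fin s) (Fin s) DC)
    (hW₁ : fromBlocks K L M N * (fromBlocks K L M N)ᴴ = 1)
    (hW₂ : (fromBlocks K L M N)ᴴ * fromBlocks K L M N = 1)
    -- `Σ₁` diagonal with positive appreciable real dual diagonal entries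
    (S₁ : Matrix (Fin r) (Fin r) DC) (d₁ : Fin r → DC)
    (hS₁ : S₁ = Matrix.diagonal d₁) (hd₁ : ∀ i, PosAppreciable (d₁ i))
    -- `Σ₂` diagonal with nonnegative infinitesimal real dual diagonal entries
    (S₂ : Matrix (Fin s) (Fin s) DC) (d₂ : Fin s → DC)
    (hS₂ : S₂ = Matrix.diagonal d₂) (hd₂ : ∀ i, NonnegInfinitesimal (d₂ i))
    -- the Hartwig–Spindelböck decomposition of `Â`
    (A : Matrix (Fin r ⊕ Fin s) (Fin r ⊕ Fin s) DC)
    (hA : A = U * fromBlocks (S₁ * K) (S₁ * L) (S₂ * M) (S₂ * N) * Uᴴ)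
    -- `Â^N`, the NDMPI of `Â`
    (AN : Matrix (Fin r ⊕ Fin s) (Fin r ⊕ Fin s) DC)
    (hAN : AN = U * fromBlocks (Kᴴ * S₁⁻¹) 0 (Lᴴ * S₁⁻¹) 0 * Uᴴ) :
    AN * AN = AN ↔ S₁ = K := by
  have hdet : IsUnit S₁.det := by
    rw [hS₁, det_diagonal]
    exact IsUnit.prod_univ_iff.mpr fun i => (hd₁ i).isUnit
  have hstar : S₁ᴴ = S₁ := by
    rw [hS₁, conjTranspose_diagonal_of_posAppreciable hd₁]
  have hKL : K * Kᴴ + L * Lᴴ = 1 := by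
    rw [fromBlocks_conjTranspose, fromBlocks_multiply, ← fromBlocks_one, fromBlocks_inj] at hW₁
    exact hW₁.1
  rw [hAN, conj_mul_self_eq_iff hU₂, fromBlocks_multiply, fromBlocks_inj]
  simp only [Matrix.mul_zero, Matrix.zero_mul, add_zero, true_and, and_true]
  constructor
  · rintro ⟨hP, hQ⟩
    have h : S₁⁻¹ * (Kᴴ * S₁⁻¹) = S₁⁻¹ := by
      calc S₁⁻¹ * (Kᴴ * S₁⁻¹)
          = (K * Kᴴ + L * Lᴴ) * (S₁⁻¹ * (Kᴴ * S₁⁻¹)) := by rw [hKL, Matrix.one_mul]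
        _ = K * (Kᴴ * S₁⁻¹ * (Kᴴ * S₁⁻¹)) + L * (Lᴴ * S₁⁻¹ * (Kᴴ * S₁⁻¹)) := by
            simp only [Matrix.add_mul, Matrix.mul_assoc]
        _ = (K * Kᴴ + L * Lᴴ) * S₁⁻¹ := by
            rw [hP, hQ]
            simp only [Matrix.add_mul, Matrix.mul_assoc]
        _ = S₁⁻¹ := by rw [hKL, Matrix.one_mul]
    have hK : Kᴴ = S₁ := by
      calc Kᴴ = S₁ * (S₁⁻¹ * (Kᴴ * S₁⁻¹)) * S₁ := by
            rw [mul_nonsing_inv_cancel_left _ _ hdet, nonsing_inv_mul_cancel_right _ _ hdet]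
        _ = S₁ := by rw [h, mul_nonsing_inv _ hdet, Matrix.one_mul]
    rw [← conjTranspose_conjTranspose_dualComplex K, hK, hstar]
  · rintro rfl
    rw [hstar, mul_nonsing_inv _ hdet, Matrix.mul_one, Matrix.mul_one]
    exact ⟨rfl, rfl⟩
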